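/- For the bipolar sigmoid μ(ς) = q·(2/(1 + exp(-ς/r)) - 1) with q, r > 0, the ratio μ(ς)/ς lies in the interval [0, q/(2r)] for every nonzero real ς. -/

import Mathlib

theorem sig_antitone : Antitone (fun t : ℝ => 2 / (1 + Real.exp (-t)) - 1 - t / 2) := by
  have hd : ∀ t : ℝ, HasDerivAt (fun t : ℝ => 2 / (1 + Real.exp (-t)) - 1 - t / 2)
      ((0 * (1 + Real.exp (-t)) - 2 * (Real.exp (-t) * (-1))) / (1 + Real.exp (-t)) ^ 2
        - 1 / 2) t := by
    intro t
    have hE : 1 + Real.exp (-t) ≠ 0 := by positivity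
    have h1 : HasDerivAt (fun t : ℝ => 1 + Real.exp (-t)) (Real.exp (-t) * (-1)) t :=
      ((hasDerivAt_neg t).exp).const_add 1
    exact ((((hasDerivAt_const t (2 : ℝ)).div h1 hE).sub_const 1).sub
      ((hasDerivAt_id t).div_const 2))
  apply antitone_of_deriv_nonpos (fun t => (hd t).differentiableAt)
  intro t
  rw [(hd t).deriv]
  have hE : 0 < Real.exp (-t) := Real.exp_pos _
  rw [sub_nonpos, div_le_div_iff₀ (by positivity) (by norm_num)]
  nlinarith [sq_nonneg (1 - Real.exp (-t))]

/-- Sector condition (13): `μ(ς)/ς ∈ [0, q/(2r)]` for the bipolar sigmoid. -/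
theorem stmt_4 (q r : ℝ) (hq : 0 < q) (hr : 0 < r)
    (μ : ℝ → ℝ)
    (hμ : ∀ ς, μ ς = q * (2 / (1 + Real.exp (-ς / r)) - 1)) :
    ∀ ς : ℝ, ς ≠ 0 → μ ς / ς ∈ Set.Icc 0 (q / (2 * r)) := by
  intro s hs
  obtain ⟨t, rfl⟩ : ∃ t, s = r * t := ⟨s / r, by field_simp⟩
  have ht : t ≠ 0 := right_ne_zero_of_mul hs
  have e : -(r * t) / r = -t := by field_simp
  rw [hμ, e]
  have key : (2 / (1 + Real.exp (-t)) - 1) / t ∈ Set.Icc (0 : ℝ) (1 / 2) := by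
    have hE : 0 < Real.exp (-t) := Real.exp_pos _
    have e2 : 2 / (1 + Real.exp (-t)) - 1 = (1 - Real.exp (-t)) / (1 + Real.exp (-t)) := by
      field_simp
      ring
    rcases lt_or_gt_of_ne ht with h | h
    · have h1 := sig_antitone h.le
      norm_num at h1
      have h2 : 1 < Real.exp (-t) := Real.one_lt_exp_iff.2 (by linarith)
      refine ⟨div_nonneg_of_nonpos ?_ h.le, ?_⟩
      · rw [e2]
        exact div_nonpos_of_nonpos_of_nonneg (by linarith) (by linarith)
      · rw [div_le_iff_of_neg h]
        linarith
    · have h1 := sig_antitone h.le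
      norm_num at h1
      have h2 : Real.exp (-t) < 1 := Real.exp_lt_one_iff.2 (by linarith)
      refine ⟨div_nonneg ?_ h.le, ?_⟩
      · rw [e2]
        exact div_nonneg (by linarith) (by linarith)
      · rw [div_le_iff₀ h]
        linarith
  have e3 : q * (2 / (1 + Real.exp (-t)) - 1) / (r * t)
      = q / r * ((2 / (1 + Real.exp (-t)) - 1) / t) := mul_div_mul_comm _ _ _ _
  have e4 : q / (2 * r) = q / r * (1 / 2) := by field_simp
  have hp : 0 < q / r := by positivity
  rw [e3, e4]
  exact ⟨mul_nonneg hp.le key.1, mul_le_mul_of_nonneg_left key.2 hp.le⟩
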